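/- Write W(k,u) := uk − V(u) and let u*(k) ∈ (u_−,u_+) denote the unique solution of V'(u) = k. Then the Fenchel–Legendre transform V*(k) := sup_{u∈D∞}(uk−V(u)) is given by: in R1, V*(k) = W(k,u*(k)) for all k ∈ ℝ; in R2, V*(k) = W(k,u*(k)) for k ≤ V'(u*_+) and V*(k) = W(k,u*_+) for k > V'(u*_+); in R3a, V*(k) = W(k,u*_−) for k < V'(u*_−) and V*(k) = W(k,u*(k)) for k ≥ V'(u*_−); in R3b, V*(k) = W(k,u*_−) for k < V'(u*_−), V*(k) = W(k,u*(k)) for V'(u*_−) ≤ k ≤ V'(1), and V*(k) = W(k,1) for k > V'(1); in R4, V*(k) = W(k,u*(k)) for k ≤ V'(1) and V*(k) = W(k,1) for k > V'(1). -/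

import Mathlib

open Real Set Filter Asymptotics

noncomputable section

namespace Heston

def dd (κ ξ ρ u : ℝ) : ℝ := Real.sqrt ((κ - ρ*ξ*u)^2 + u*(1-u)*ξ^2)

def mu (κ θ ξ : ℝ) : ℝ := 2*κ*θ/ξ^2

def VV (κ θ ξ ρ u : ℝ) : ℝ := mu κ θ ξ / 2 * (κ - ρ*ξ*u - dd κ ξ ρ u)

def gam (κ ξ ρ u : ℝ) : ℝ := (κ - ρ*ξ*u - dd κ ξ ρ u) / (κ - ρ*ξ*u + dd κ ξ ρ u)

def bet (κ ξ t : ℝ) : ℝ := ξ^2/(4*κ) * (1 - Real.exp (-(κ*t)))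

def HH (κ θ ξ ρ v t u : ℝ) : ℝ :=
  VV κ θ ξ ρ u * v * Real.exp (-(κ*t)) / (κ*θ - 2 * bet κ ξ t * VV κ θ ξ ρ u)
  - mu κ θ ξ * Real.log ((κ*θ - 2 * bet κ ξ t * VV κ θ ξ ρ u) / (κ*θ*(1 - gam κ ξ ρ u)))

def eta (κ ξ ρ : ℝ) : ℝ := Real.sqrt (ξ^2*(1-ρ^2) + (2*κ - ρ*ξ)^2)

def uplus (κ ξ ρ : ℝ) : ℝ := (ξ - 2*κ*ρ + eta κ ξ ρ) / (2*ξ*(1-ρ^2))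

def uminus (κ ξ ρ : ℝ) : ℝ := (ξ - 2*κ*ρ - eta κ ξ ρ) / (2*ξ*(1-ρ^2))

def psi (κ ξ ρ t : ℝ) : ℝ := ξ*(Real.exp (κ*t) - 1) - 4*κ*ρ*Real.exp (κ*t)

def nuu (κ ξ ρ t : ℝ) : ℝ := Real.sqrt ((psi κ ξ ρ t)^2 - 16*κ^2*Real.exp (κ*t))

def ustarplus (κ ξ ρ t : ℝ) : ℝ := (psi κ ξ ρ t + nuu κ ξ ρ t) / (2*ξ*(Real.exp (κ*t) - 1))

def ustarminus (κ ξ ρ t : ℝ) : ℝ := (psi κ ξ ρ t - nuu κ ξ ρ t) / (2*ξ*(Real.exp (κ*t) - 1))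

def rhoplus (κ ξ t : ℝ) : ℝ :=
  Real.exp (-(2*κ*t)) * (ξ*(Real.exp (2*κ*t) - 1)
    + (Real.exp (κ*t) + 1) * Real.sqrt (16*κ^2*Real.exp (2*κ*t) + ξ^2*(1 - Real.exp (κ*t))^2)) / (8*κ)

def rhominus (κ ξ t : ℝ) : ℝ :=
  Real.exp (-(2*κ*t)) * (ξ*(Real.exp (2*κ*t) - 1)
    - (Real.exp (κ*t) + 1) * Real.sqrt (16*κ^2*Real.exp (2*κ*t) + ξ^2*(1 - Real.exp (κ*t))^2)) / (8*κ)

def R1 (κ ξ ρ t : ℝ) : Prop := rhominus κ ξ t ≤ ρ ∧ ρ ≤ min (rhoplus κ ξ t) (κ/ξ)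
def R2 (κ ξ ρ t : ℝ) : Prop := -1 < ρ ∧ ρ < rhominus κ ξ t
def R3a (κ ξ ρ t : ℝ) : Prop := rhoplus κ ξ t < ρ ∧ ρ < 1 ∧ ρ ≤ κ/ξ
def R3b (κ ξ ρ t : ℝ) : Prop := rhoplus κ ξ t < ρ ∧ ρ < 1 ∧ κ/ξ < ρ
def R4 (κ ξ ρ t : ℝ) : Prop := κ/ξ < ρ ∧ ρ ≤ min (rhoplus κ ξ t) 1

def D1 (κ ξ ρ : ℝ) : Set ℝ := Set.Icc (uminus κ ξ ρ) (uplus κ ξ ρ)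
def D2 (κ ξ ρ t : ℝ) : Set ℝ := Set.Ico (uminus κ ξ ρ) (ustarplus κ ξ ρ t)
def D3a (κ ξ ρ t : ℝ) : Set ℝ := Set.Ioc (ustarminus κ ξ ρ t) (uplus κ ξ ρ)
def D3b (κ ξ ρ t : ℝ) : Set ℝ := Set.Ioc (ustarminus κ ξ ρ t) 1
def D4 (κ ξ ρ : ℝ) : Set ℝ := Set.Ioc (uminus κ ξ ρ) 1

def regimeD (κ ξ ρ t : ℝ) (D : Set ℝ) : Prop :=
  (R1 κ ξ ρ t ∧ D = D1 κ ξ ρ) ∨ (R2 κ ξ ρ t ∧ D = D2 κ ξ ρ t) ∨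
  (R3a κ ξ ρ t ∧ D = D3a κ ξ ρ t) ∨ (R3b κ ξ ρ t ∧ D = D3b κ ξ ρ t) ∨
  (R4 κ ξ ρ t ∧ D = D4 κ ξ ρ)

def Vstar (κ θ ξ ρ : ℝ) (D : Set ℝ) (k : ℝ) : ℝ :=
  sSup ((fun u => u*k - VV κ θ ξ ρ u) '' D)

def ZZ (κ θ ξ ρ k : ℝ) : ℝ :=
  if k < deriv (VV κ θ ξ ρ) 0 then -1
  else if k ≤ deriv (VV κ θ ξ ρ) 1 then 1
  else if κ ≤ ρ*ξ then 1 else -1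

def v0inf (κ θ ξ ρ : ℝ) (D : Set ℝ) (k : ℝ) : ℝ :=
  2*(2*Vstar κ θ ξ ρ D k - k
    + 2*ZZ κ θ ξ ρ k * Real.sqrt (Vstar κ θ ξ ρ D k * (Vstar κ θ ξ ρ D k - k)))

lemma csSup_image_eq_of_mem_closure {g : ℝ → ℝ} {S : Set ℝ} {x : ℝ} (hg : Continuous g)
    (hx : x ∈ closure S) (hle : ∀ u ∈ S, g u ≤ g x) : sSup (g '' S) = g x := by
  have hne : (g '' S).Nonempty := (closure_nonempty_iff.mp ⟨x, hx⟩).image g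
  refine IsLUB.csSup_eq ?_ hne
  refine isLUB_of_mem_closure ?_ (image_closure_subset_closure_image hg ⟨x, hx, rfl⟩)
  rintro _ ⟨u, hu, rfl⟩
  exact hle u hu

/-- The radicand of `dd`. -/
def radicand (κ ξ ρ u : ℝ) : ℝ := (κ - ρ*ξ*u)^2 + u*(1-u)*ξ^2

lemma continuous_VV (κ θ ξ ρ : ℝ) : Continuous (VV κ θ ξ ρ) := by
  unfold VV dd
  fun_prop

lemma continuous_mul_sub_VV (κ θ ξ ρ k : ℝ) : Continuous (fun u => u*k - VV κ θ ξ ρ u) := by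
  have := continuous_VV κ θ ξ ρ
  fun_prop

lemma radicand_eq_mul {κ ξ ρ : ℝ} (hξ : 0 < ξ) (hρ₁ : -1 < ρ) (hρ₂ : ρ < 1) (u : ℝ) :
    radicand κ ξ ρ u = ξ^2*(1-ρ^2) * ((u - uminus κ ξ ρ) * (uplus κ ξ ρ - u)) := by
  have h1 : 0 < 1 - ρ^2 := by nlinarith
  have hs : eta κ ξ ρ ^ 2 = ξ^2*(1-ρ^2) + (2*κ - ρ*ξ)^2 := by
    unfold eta
    exact Real.sq_sqrt (by positivity)
  unfold radicand uminus uplus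
  field_simp
  linear_combination (-1) * hs

lemma uminus_le_uplus {κ ξ ρ : ℝ} (hξ : 0 < ξ) (hρ₁ : -1 < ρ) (hρ₂ : ρ < 1) :
    uminus κ ξ ρ ≤ uplus κ ξ ρ := by
  have h1 : 0 < 1 - ρ^2 := by nlinarith
  have h2 : 0 ≤ eta κ ξ ρ := Real.sqrt_nonneg _
  unfold uminus uplus
  gcongr
  linarith

lemma radicand_nonneg_iff {κ ξ ρ : ℝ} (hξ : 0 < ξ) (hρ₁ : -1 < ρ) (hρ₂ : ρ < 1) {u : ℝ} :
    0 ≤ radicand κ ξ ρ u ↔ u ∈ Icc (uminus κ ξ ρ) (uplus κ ξ ρ) := by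
  have h1 : 0 < ξ^2*(1-ρ^2) := mul_pos (by positivity) (by nlinarith)
  have h2 := uminus_le_uplus (κ := κ) hξ hρ₁ hρ₂
  rw [radicand_eq_mul hξ hρ₁ hρ₂, mul_nonneg_iff_of_pos_left h1, mul_nonneg_iff, mem_Icc]
  constructor
  · rintro (⟨h, h'⟩ | ⟨h, h'⟩) <;> constructor <;> linarith
  · rintro ⟨h, h'⟩
    left
    constructor <;> linarith

lemma radicand_pos_iff {κ ξ ρ : ℝ} (hξ : 0 < ξ) (hρ₁ : -1 < ρ) (hρ₂ : ρ < 1) {u : ℝ} :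
    0 < radicand κ ξ ρ u ↔ u ∈ Ioo (uminus κ ξ ρ) (uplus κ ξ ρ) := by
  have h1 : 0 < ξ^2*(1-ρ^2) := mul_pos (by positivity) (by nlinarith)
  have h2 := uminus_le_uplus (κ := κ) hξ hρ₁ hρ₂
  rw [radicand_eq_mul hξ hρ₁ hρ₂, mul_pos_iff_of_pos_left h1, mul_pos_iff, mem_Ioo]
  constructor
  · rintro (⟨h, h'⟩ | ⟨h, h'⟩) <;> constructor <;> linarith
  · rintro ⟨h, h'⟩
    left
    constructor <;> linarith

lemma hasDerivAt_VV {κ θ ξ ρ y : ℝ} (hy : 0 < radicand κ ξ ρ y) :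
    HasDerivAt (VV κ θ ξ ρ)
      (mu κ θ ξ / 2 * (-(ρ*ξ)
        - (ξ*(ξ - 2*κ*ρ) - 2*ξ^2*(1-ρ^2)*y) / (2 * √(radicand κ ξ ρ y)))) y := by
  have hl : HasDerivAt (fun u => κ - ρ*ξ*u) (-(ρ*ξ)) y := by
    simpa using ((hasDerivAt_id y).const_mul (ρ*ξ)).const_sub κ
  have hq : HasDerivAt (radicand κ ξ ρ) (ξ*(ξ - 2*κ*ρ) - 2*ξ^2*(1-ρ^2)*y) y := by
    have h := (hl.pow 2).add
      (((hasDerivAt_id y).mul ((hasDerivAt_id y).const_sub 1)).mul_const (ξ^2))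
    refine HasDerivAt.congr_deriv (f := radicand κ ξ ρ) h ?_
    simp
    ring
  exact (hl.sub (hq.sqrt hy.ne')).const_mul (mu κ θ ξ / 2)

/-- Convexity of `VV`: its graph lies above each tangent line. -/
lemma VV_add_deriv_mul_le {κ θ ξ ρ y u : ℝ} (hκ : 0 < κ) (hθ : 0 < θ)
    (hρ₁ : -1 < ρ) (hρ₂ : ρ < 1) (hy : 0 < radicand κ ξ ρ y) (hu : 0 ≤ radicand κ ξ ρ u) :
    VV κ θ ξ ρ y + deriv (VV κ θ ξ ρ) y * (u - y) ≤ VV κ θ ξ ρ u := by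
  have hmu : 0 ≤ mu κ θ ξ / 2 := by unfold mu; positivity
  have hρ : 0 ≤ 1 - ρ^2 := by nlinarith
  rw [(hasDerivAt_VV hy).deriv]
  have hVV : ∀ x, VV κ θ ξ ρ x = mu κ θ ξ / 2 * (κ - ρ*ξ*x - √(radicand κ ξ ρ x)) :=
    fun _ => rfl
  rw [hVV, hVV, mul_assoc (mu κ θ ξ / 2) (_ - _), ← mul_add]
  refine mul_le_mul_of_nonneg_left ?_ hmu
  have ha : 0 < √(radicand κ ξ ρ y) := Real.sqrt_pos.mpr hy
  have haa := Real.sq_sqrt hy.le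
  have hbb := Real.sq_sqrt hu
  set a := √(radicand κ ξ ρ y)
  set b := √(radicand κ ξ ρ u)
  set q := ξ*(ξ - 2*κ*ρ) - 2*ξ^2*(1-ρ^2)*y with hq
  have key : b ≤ a + q / (2*a) * (u - y) := by
    have hexp : b^2 = a^2 + q*(u-y) - ξ^2*(1-ρ^2)*(u-y)^2 := by
      rw [haa, hbb, hq]
      unfold radicand
      ring
    have hnn : 0 ≤ ξ^2*(1-ρ^2)*(u-y)^2 := by positivity
    have : a + q / (2*a) * (u - y) - b = (2*a^2 + q*(u-y) - 2*a*b) / (2*a) := by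
      field_simp
    have h2 : 0 ≤ (2*a^2 + q*(u-y) - 2*a*b) / (2*a) :=
      div_nonneg (by nlinarith [sq_nonneg (a - b)]) (by positivity)
    linarith
  linarith

lemma mul_sub_VV_le {κ θ ξ ρ y u k : ℝ} (hκ : 0 < κ) (hθ : 0 < θ)
    (hρ₁ : -1 < ρ) (hρ₂ : ρ < 1) (hy : 0 < radicand κ ξ ρ y) (hu : 0 ≤ radicand κ ξ ρ u)
    (h : (u - y) * (k - deriv (VV κ θ ξ ρ) y) ≤ 0) :
    u*k - VV κ θ ξ ρ u ≤ y*k - VV κ θ ξ ρ y := by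
  linarith [VV_add_deriv_mul_le hκ hθ hρ₁ hρ₂ hy hu]

/-- The discriminating quadratic in the correlation, whose roots are `rhominus` and `rhoplus`. -/
def corrQuad (κ ξ ρ t : ℝ) : ℝ :=
  4*κ*Real.exp (κ*t)^2*ρ^2 - ρ*ξ*(Real.exp (κ*t)^2 - 1) - κ*(Real.exp (κ*t) + 1)^2

lemma corrQuad_pos {κ ξ ρ t : ℝ} (hκ : 0 < κ) (h : ρ < rhominus κ ξ t ∨ rhoplus κ ξ t < ρ) :
    0 < corrQuad κ ξ ρ t := by
  have hE := Real.exp_pos (κ*t)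
  have h2 : Real.exp (2*κ*t) = Real.exp (κ*t)^2 := by
    rw [← Real.exp_nat_mul]; congr 1; push_cast; ring
  unfold rhominus rhoplus at h
  rw [Real.exp_neg, h2] at h
  unfold corrQuad
  set E := Real.exp (κ*t)
  have hS : 0 ≤ √(16*κ^2*E^2 + ξ^2*(1 - E)^2) := Real.sqrt_nonneg _
  have hSS : √(16*κ^2*E^2 + ξ^2*(1 - E)^2)^2 = 16*κ^2*E^2 + ξ^2*(1 - E)^2 :=
    Real.sq_sqrt (by positivity)
  set S := √(16*κ^2*E^2 + ξ^2*(1 - E)^2)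
  have hT : 0 ≤ (E+1)*S := by positivity
  have hX : ((E+1)*S)^2 < (8*κ*E^2*ρ - ξ*(E^2-1))^2 := by
    rcases h with h | h
    · rw [inv_mul_eq_div, div_div, lt_div_iff₀ (by positivity)] at h
      nlinarith
    · rw [inv_mul_eq_div, div_div, div_lt_iff₀ (by positivity)] at h
      nlinarith
  have h3 : 0 < 16*κ*E^2 * (4*κ*E^2*ρ^2 - ρ*ξ*(E^2 - 1) - κ*(E + 1)^2) := by
    rw [mul_pow, hSS] at hX
    linarith
  exact pos_of_mul_pos_right h3 (by positivity)

lemma nuu_sq {κ ξ ρ t : ℝ} (hκ : 0 < κ) (h : 0 < corrQuad κ ξ ρ t) :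
    nuu κ ξ ρ t^2 = psi κ ξ ρ t^2 - 16*κ^2*Real.exp (κ*t) := by
  refine Real.sq_sqrt ?_
  unfold corrQuad at h
  unfold psi
  set E := Real.exp (κ*t)
  have hE : 0 < E := Real.exp_pos _
  have hρ : 0 < ρ^2 := by
    rcases eq_or_ne ρ 0 with rfl | h0
    · nlinarith [mul_pos hκ (pow_pos (by linarith : 0 < E+1) 2)]
    · positivity
  refine (mul_nonneg_iff_of_pos_left hρ).mp ?_
  nlinarith [sq_nonneg (2*κ*(E+1) + ρ*(ξ*(E - 1) - 4*κ*ρ*E)), mul_pos hκ h]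

lemma radicand_pos_of_root {κ ξ ρ t y : ℝ} (hκ : 0 < κ) (ht : 0 < t)
    (h : 0 < corrQuad κ ξ ρ t)
    (hy : (2*ξ*(Real.exp (κ*t) - 1)*y - psi κ ξ ρ t)^2
      = psi κ ξ ρ t^2 - 16*κ^2*Real.exp (κ*t)) :
    0 < radicand κ ξ ρ y := by
  have hE : 1 < Real.exp (κ*t) := Real.one_lt_exp_iff.mpr (by positivity)
  unfold corrQuad at h
  unfold psi at hy
  unfold radicand
  set E := Real.exp (κ*t)
  have hsq : (E-1)^2 * ((κ - ρ*ξ*y)^2 + y*(1-y)*ξ^2) = ((E-1)*(κ - ρ*ξ*y) - 2*κ*E)^2 := by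
    linear_combination (-1/4) * hy
  have hne : (E-1)*(κ - ρ*ξ*y) - 2*κ*E ≠ 0 := by
    intro h0
    have h1 : ρ*ξ*(E-1)*y = -(κ*(E+1)) := by linear_combination (-1)*h0
    have h2 : κ * (4*κ*E^2*ρ^2 - ρ*ξ*(E^2 - 1) - κ*(E + 1)^2) = 0 := by
      linear_combination (-ρ^2/4)*hy + (ρ*ξ*(E-1)*y - κ*(E+1) - ρ*(ξ*(E - 1) - 4*κ*ρ*E))*h1
    exact (mul_pos hκ h).ne' h2
  have h3 : 0 < (E-1)^2 * ((κ - ρ*ξ*y)^2 + y*(1-y)*ξ^2) := by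
    rw [hsq]
    positivity
  exact pos_of_mul_pos_right h3 (by positivity)

lemma radicand_ustarplus_pos {κ ξ ρ t : ℝ} (hκ : 0 < κ) (hξ : 0 < ξ) (ht : 0 < t)
    (h : 0 < corrQuad κ ξ ρ t) : 0 < radicand κ ξ ρ (ustarplus κ ξ ρ t) := by
  have hE : 1 < Real.exp (κ*t) := Real.one_lt_exp_iff.mpr (by positivity)
  have hd : 2*ξ*(Real.exp (κ*t) - 1) ≠ 0 := (mul_pos (by positivity) (by linarith)).ne'
  refine radicand_pos_of_root hκ ht h ?_
  rw [ustarplus, mul_div_cancel₀ _ hd, add_sub_cancel_left, nuu_sq hκ h]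

lemma radicand_ustarminus_pos {κ ξ ρ t : ℝ} (hκ : 0 < κ) (hξ : 0 < ξ) (ht : 0 < t)
    (h : 0 < corrQuad κ ξ ρ t) : 0 < radicand κ ξ ρ (ustarminus κ ξ ρ t) := by
  have hE : 1 < Real.exp (κ*t) := Real.one_lt_exp_iff.mpr (by positivity)
  have hd : 2*ξ*(Real.exp (κ*t) - 1) ≠ 0 := (mul_pos (by positivity) (by linarith)).ne'
  refine radicand_pos_of_root hκ ht h ?_
  rw [ustarminus, mul_div_cancel₀ _ hd, sub_sub_cancel_left, neg_sq, nuu_sq hκ h]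

lemma ustarminus_lt_one {κ ξ ρ t : ℝ} (hκ : 0 < κ) (hξ : 0 < ξ) (ht : 0 < t) (hρ : 0 < ρ) :
    ustarminus κ ξ ρ t < 1 := by
  have hE : 1 < Real.exp (κ*t) := Real.one_lt_exp_iff.mpr (by positivity)
  have hn : 0 ≤ nuu κ ξ ρ t := Real.sqrt_nonneg _
  have hd : 0 < ξ*(Real.exp (κ*t) - 1) := mul_pos hξ (by linarith)
  have hp : 0 < 4*κ*ρ*Real.exp (κ*t) := by positivity
  rw [ustarminus, div_lt_one (by linarith), psi]
  linarith

/-- If `V' x = k`, the supremum of `W` over a set with closure `[a, b]` is attained at `x`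
as soon as the derivatives at the endpoints that cut off part of the domain bracket `k`. -/
lemma Vstar_eq_of_deriv_eq {κ θ ξ ρ a b x k : ℝ} {D : Set ℝ} (hκ : 0 < κ) (hθ : 0 < θ)
    (hξ : 0 < ξ) (hρ₁ : -1 < ρ) (hρ₂ : ρ < 1)
    (hx : x ∈ Ioo (uminus κ ξ ρ) (uplus κ ξ ρ)) (hk : deriv (VV κ θ ξ ρ) x = k)
    (hab : a ≤ b) (hD : closure D = Icc a b) (hsub : Icc a b ⊆ Icc (uminus κ ξ ρ) (uplus κ ξ ρ))
    (ha : a = uminus κ ξ ρ ∨ 0 < radicand κ ξ ρ a ∧ deriv (VV κ θ ξ ρ) a ≤ k)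
    (hb : b = uplus κ ξ ρ ∨ 0 < radicand κ ξ ρ b ∧ k ≤ deriv (VV κ θ ξ ρ) b) :
    Vstar κ θ ξ ρ D k = x*k - VV κ θ ξ ρ x := by
  have hxpos := (radicand_pos_iff hξ hρ₁ hρ₂).mpr hx
  have hmax : ∀ u ∈ Icc (uminus κ ξ ρ) (uplus κ ξ ρ),
      u*k - VV κ θ ξ ρ u ≤ x*k - VV κ θ ξ ρ x := fun u hu =>
    mul_sub_VV_le hκ hθ hρ₁ hρ₂ hxpos ((radicand_nonneg_iff hξ hρ₁ hρ₂).mpr hu) (by simp [hk])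
  obtain ⟨z, hz, hzx⟩ : ∃ z ∈ Icc a b, z*k - VV κ θ ξ ρ z = x*k - VV κ θ ξ ρ x := by
    rcases lt_or_ge x a with hxa | hxa
    · rcases ha with rfl | ⟨hap, hak⟩
      · exact absurd hx.1 hxa.not_gt
      · refine ⟨a, left_mem_Icc.mpr hab, (hmax a (hsub (left_mem_Icc.mpr hab))).antisymm ?_⟩
        exact mul_sub_VV_le hκ hθ hρ₁ hρ₂ hap hxpos.le
          (mul_nonpos_of_nonpos_of_nonneg (by linarith) (by linarith))
    rcases lt_or_ge b x with hxb | hxb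
    · rcases hb with rfl | ⟨hbp, hbk⟩
      · exact absurd hx.2 hxb.not_gt
      · refine ⟨b, right_mem_Icc.mpr hab, (hmax b (hsub (right_mem_Icc.mpr hab))).antisymm ?_⟩
        exact mul_sub_VV_le hκ hθ hρ₁ hρ₂ hbp hxpos.le
          (mul_nonpos_of_nonneg_of_nonpos (by linarith) (by linarith))
    exact ⟨x, ⟨hxa, hxb⟩, rfl⟩
  rw [← hzx]
  refine csSup_image_eq_of_mem_closure (continuous_mul_sub_VV κ θ ξ ρ k) (hD ▸ hz) ?_
  intro u hu
  rw [hzx]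
  exact hmax u (hsub (hD ▸ subset_closure hu))

/-- If `(u - y) (k - V' y) ≤ 0` on the domain, the supremum of `W` is its value at the
boundary point `y`. -/
lemma Vstar_eq_boundary {κ θ ξ ρ y k : ℝ} {D : Set ℝ} (hκ : 0 < κ) (hθ : 0 < θ)
    (hξ : 0 < ξ) (hρ₁ : -1 < ρ) (hρ₂ : ρ < 1) (hy : 0 < radicand κ ξ ρ y)
    (hyD : y ∈ closure D) (hsub : D ⊆ Icc (uminus κ ξ ρ) (uplus κ ξ ρ))
    (h : ∀ u ∈ D, (u - y) * (k - deriv (VV κ θ ξ ρ) y) ≤ 0) :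
    Vstar κ θ ξ ρ D k = y*k - VV κ θ ξ ρ y :=
  csSup_image_eq_of_mem_closure (continuous_mul_sub_VV κ θ ξ ρ k) hyD fun u hu =>
    mul_sub_VV_le hκ hθ hρ₁ hρ₂ hy ((radicand_nonneg_iff hξ hρ₁ hρ₂).mpr (hsub hu)) (h u hu)

theorem stmt4 (κ θ ξ ρ v t : ℝ) (hκ : 0 < κ) (hθ : 0 < θ) (hξ : 0 < ξ) (hv : 0 < v)
    (hρ₁ : -1 < ρ) (hρ₂ : ρ < 1) (ht : 0 < t)
    (us : ℝ → ℝ)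
    (hus : ∀ k : ℝ, us k ∈ Set.Ioo (uminus κ ξ ρ) (uplus κ ξ ρ) ∧
      deriv (VV κ θ ξ ρ) (us k) = k) :
    (R1 κ ξ ρ t → ∀ k : ℝ,
      Vstar κ θ ξ ρ (D1 κ ξ ρ) k = us k * k - VV κ θ ξ ρ (us k)) ∧
    (R2 κ ξ ρ t → ∀ k : ℝ,
      (k ≤ deriv (VV κ θ ξ ρ) (ustarplus κ ξ ρ t) →
        Vstar κ θ ξ ρ (D2 κ ξ ρ t) k = us k * k - VV κ θ ξ ρ (us k)) ∧
      (deriv (VV κ θ ξ ρ) (ustarplus κ ξ ρ t) < k →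
        Vstar κ θ ξ ρ (D2 κ ξ ρ t) k
          = ustarplus κ ξ ρ t * k - VV κ θ ξ ρ (ustarplus κ ξ ρ t))) ∧
    (R3a κ ξ ρ t → ∀ k : ℝ,
      (k < deriv (VV κ θ ξ ρ) (ustarminus κ ξ ρ t) →
        Vstar κ θ ξ ρ (D3a κ ξ ρ t) k
          = ustarminus κ ξ ρ t * k - VV κ θ ξ ρ (ustarminus κ ξ ρ t)) ∧
      (deriv (VV κ θ ξ ρ) (ustarminus κ ξ ρ t) ≤ k →
        Vstar κ θ ξ ρ (D3a κ ξ ρ t) k = us k * k - VV κ θ ξ ρ (us k))) ∧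
    (R3b κ ξ ρ t → ∀ k : ℝ,
      (k < deriv (VV κ θ ξ ρ) (ustarminus κ ξ ρ t) →
        Vstar κ θ ξ ρ (D3b κ ξ ρ t) k
          = ustarminus κ ξ ρ t * k - VV κ θ ξ ρ (ustarminus κ ξ ρ t)) ∧
      (deriv (VV κ θ ξ ρ) (ustarminus κ ξ ρ t) ≤ k → k ≤ deriv (VV κ θ ξ ρ) 1 →
        Vstar κ θ ξ ρ (D3b κ ξ ρ t) k = us k * k - VV κ θ ξ ρ (us k)) ∧
      (deriv (VV κ θ ξ ρ) 1 < k →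
        Vstar κ θ ξ ρ (D3b κ ξ ρ t) k = 1 * k - VV κ θ ξ ρ 1)) ∧
    (R4 κ ξ ρ t → ∀ k : ℝ,
      (k ≤ deriv (VV κ θ ξ ρ) 1 →
        Vstar κ θ ξ ρ (D4 κ ξ ρ) k = us k * k - VV κ θ ξ ρ (us k)) ∧
      (deriv (VV κ θ ξ ρ) 1 < k →
        Vstar κ θ ξ ρ (D4 κ ξ ρ) k = 1 * k - VV κ θ ξ ρ 1)) := by
  have hmem {y : ℝ} (hy : 0 < radicand κ ξ ρ y) := (radicand_pos_iff hξ hρ₁ hρ₂).mp hy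
  have hone : κ/ξ < ρ → 0 < radicand κ ξ ρ 1 := by
    intro h
    rw [div_lt_iff₀ hξ] at h
    have : κ - ρ*ξ ≠ 0 := by linarith
    simp only [radicand, mul_one, sub_self, mul_zero, zero_mul, add_zero]
    positivity
  refine ⟨fun _ k => ?_, fun h k => ?_, fun h k => ?_, fun h k => ?_, fun h k => ?_⟩
  · exact Vstar_eq_of_deriv_eq hκ hθ hξ hρ₁ hρ₂ (hus k).1 (hus k).2
      (uminus_le_uplus hξ hρ₁ hρ₂) isClosed_Icc.closure_eq subset_rfl (.inl rfl) (.inl rfl)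
  · have hy := radicand_ustarplus_pos hκ hξ ht (corrQuad_pos hκ (.inl h.2))
    obtain ⟨hl, hr⟩ := hmem hy
    have hcl : closure (D2 κ ξ ρ t) = Icc _ _ := closure_Ico hl.ne
    have hsub := Icc_subset_Icc (le_refl (uminus κ ξ ρ)) hr.le
    refine ⟨fun hk => ?_, fun hk => ?_⟩
    · exact Vstar_eq_of_deriv_eq hκ hθ hξ hρ₁ hρ₂ (hus k).1 (hus k).2 hl.le hcl hsub
        (.inl rfl) (.inr ⟨hy, hk⟩)
    · refine Vstar_eq_boundary hκ hθ hξ hρ₁ hρ₂ hy (hcl ▸ right_mem_Icc.mpr hl.le)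
        (Ico_subset_Icc_self.trans hsub) fun u hu => ?_
      exact mul_nonpos_of_nonpos_of_nonneg (by linarith [hu.2]) (by linarith)
  · have hy := radicand_ustarminus_pos hκ hξ ht (corrQuad_pos hκ (.inr h.1))
    obtain ⟨hl, hr⟩ := hmem hy
    have hcl : closure (D3a κ ξ ρ t) = Icc _ _ := closure_Ioc hr.ne
    have hsub := Icc_subset_Icc hl.le (le_refl (uplus κ ξ ρ))
    refine ⟨fun hk => ?_, fun hk => ?_⟩
    · refine Vstar_eq_boundary hκ hθ hξ hρ₁ hρ₂ hy (hcl ▸ left_mem_Icc.mpr hr.le)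
        (Ioc_subset_Icc_self.trans hsub) fun u hu => ?_
      exact mul_nonpos_of_nonneg_of_nonpos (by linarith [hu.1]) (by linarith)
    · exact Vstar_eq_of_deriv_eq hκ hθ hξ hρ₁ hρ₂ (hus k).1 (hus k).2 hr.le hcl hsub
        (.inr ⟨hy, hk⟩) (.inl rfl)
  · have hy := radicand_ustarminus_pos hκ hξ ht (corrQuad_pos hκ (.inr h.1))
    have h1 := hone h.2.2
    have hlt := ustarminus_lt_one hκ hξ ht ((div_pos hκ hξ).trans h.2.2)
    have hcl : closure (D3b κ ξ ρ t) = Icc _ _ := closure_Ioc hlt.ne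
    have hsub := Icc_subset_Icc (hmem hy).1.le (hmem h1).2.le
    refine ⟨fun hk => ?_, fun hk hk' => ?_, fun hk => ?_⟩
    · refine Vstar_eq_boundary hκ hθ hξ hρ₁ hρ₂ hy (hcl ▸ left_mem_Icc.mpr hlt.le)
        (Ioc_subset_Icc_self.trans hsub) fun u hu => ?_
      exact mul_nonpos_of_nonneg_of_nonpos (by linarith [hu.1]) (by linarith)
    · exact Vstar_eq_of_deriv_eq hκ hθ hξ hρ₁ hρ₂ (hus k).1 (hus k).2 hlt.le hcl hsub
        (.inr ⟨hy, hk⟩) (.inr ⟨h1, hk'⟩)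
    · refine Vstar_eq_boundary hκ hθ hξ hρ₁ hρ₂ h1 (hcl ▸ right_mem_Icc.mpr hlt.le)
        (Ioc_subset_Icc_self.trans hsub) fun u hu => ?_
      exact mul_nonpos_of_nonpos_of_nonneg (by linarith [hu.2]) (by linarith)
  · have h1 := hone h.1
    obtain ⟨hl, hr⟩ := hmem h1
    have hcl : closure (D4 κ ξ ρ) = Icc _ _ := closure_Ioc hl.ne
    have hsub := Icc_subset_Icc (le_refl (uminus κ ξ ρ)) hr.le
    refine ⟨fun hk => ?_, fun hk => ?_⟩
    · exact Vstar_eq_of_deriv_eq hκ hθ hξ hρ₁ hρ₂ (hus k).1 (hus k).2 hl.le hcl hsub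
        (.inl rfl) (.inr ⟨h1, hk⟩)
    · refine Vstar_eq_boundary hκ hθ hξ hρ₁ hρ₂ h1 (hcl ▸ right_mem_Icc.mpr hl.le)
        (Ioc_subset_Icc_self.trans hsub) fun u hu => ?_
      exact mul_nonpos_of_nonpos_of_nonneg (by linarith [hu.2]) (by linarith)

end Heston
end
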